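/- arXiv:2001.06947 — 6 statements merged into one kernel-verified Lean document; each statement's English description precedes it below -/
import Mathlib

section
/- Let m be an integer and let ξ = (ξ₁, ξ₂) ∈ ℂ². Set z = ξ₁ + iξ₂ and z* = ξ₁ − iξ₂. Then (1/2π) ∫_{S¹} e^{ϑ·ξ} (ϑ₁ + iϑ₂)^m dσ(ϑ) equals (z/2)^m Σ_{n=0}^∞ (z*z)^n / (4^n n! (m+n)!) if m ≥ 0, and equals (z*/2)^{−m} Σ_{n=0}^∞ (z*z)^n / (4^n n! (−m+n)!) if m < 0. -/
open MeasureTheory Real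

/-- Orthogonality of the characters of the circle. -/
theorem integral_exp_mul_I_zpow (j : ℤ) :
    ∫ θ in (0:ℝ)..(2 * π), Complex.exp (θ * Complex.I) ^ j
      = if j = 0 then 2 * (π : ℂ) else 0 := by
  split_ifs with hj
  · simp [hj]
  · have hc : (j : ℂ) * Complex.I ≠ 0 := by simp [hj]
    have h : ∀ θ : ℝ, Complex.exp (θ * Complex.I) ^ j
        = Complex.exp ((j : ℂ) * Complex.I * θ) := fun θ => by
      rw [← Complex.exp_int_mul]; ring_nf
    simp_rw [h]
    rw [integral_exp_mul_complex hc]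
    have : (j : ℂ) * Complex.I * ((2 * π : ℝ) : ℂ) = j * (2 * π * Complex.I) := by
      push_cast; ring
    rw [this, Complex.exp_int_mul_two_pi_mul_I]
    simp

/-- The double exponential series of `exp (a * e^{-iθ} + b * e^{iθ})` can be integrated termwise
against a character of the circle. -/
theorem hasSum_integral_exp_mul_zpow (m : ℤ) (a b : ℂ) :
    HasSum (fun p : ℕ × ℕ => a ^ p.1 / (p.1.factorial : ℂ) * (b ^ p.2 / (p.2.factorial : ℂ)) *
        if (p.2 : ℤ) - p.1 + m = 0 then 2 * (π : ℂ) else 0)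
      (∫ θ in (0:ℝ)..(2 * π),
        Complex.exp (a * (Complex.exp (θ * Complex.I))⁻¹ + b * Complex.exp (θ * Complex.I)) *
          Complex.exp (θ * Complex.I) ^ m) := by
  have hexp : ∀ x : ℂ, HasSum (fun n : ℕ => x ^ n / (n.factorial : ℂ)) (Complex.exp x) :=
    fun x => by
      rw [Complex.exp_eq_exp_ℂ]
      exact NormedSpace.expSeries_div_hasSum_exp x
  have hnorm : ∀ x : ℂ, Summable fun n : ℕ => ‖x ^ n / (n.factorial : ℂ)‖ :=
    fun x => NormedSpace.norm_expSeries_div_summable x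
  have hbound : Summable fun p : ℕ × ℕ =>
      ‖a ^ p.1 / (p.1.factorial : ℂ)‖ * ‖b ^ p.2 / (p.2.factorial : ℂ)‖ :=
    (hnorm a).mul_of_nonneg (hnorm b) (fun _ => norm_nonneg _) fun _ => norm_nonneg _
  have key := intervalIntegral.hasSum_integral_of_dominated_convergence
    (μ := volume) (a := (0:ℝ)) (b := 2 * π)
    (F := fun (p : ℕ × ℕ) (θ : ℝ) =>
      a ^ p.1 / (p.1.factorial : ℂ) * (b ^ p.2 / (p.2.factorial : ℂ)) *
        Complex.exp (θ * Complex.I) ^ ((p.2 : ℤ) - p.1 + m))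
    (f := fun θ : ℝ =>
      Complex.exp (a * (Complex.exp (θ * Complex.I))⁻¹ + b * Complex.exp (θ * Complex.I)) *
          Complex.exp (θ * Complex.I) ^ m)
    (fun p _ => ‖a ^ p.1 / (p.1.factorial : ℂ)‖ * ‖b ^ p.2 / (p.2.factorial : ℂ)‖)
    (fun p => ?_) (fun p => ?_) ?_ ?_ ?_
  · simpa only [intervalIntegral.integral_const_mul, integral_exp_mul_I_zpow] using key
  · refine Continuous.aestronglyMeasurable (continuous_const.mul ?_)
    exact Continuous.zpow₀ (by fun_prop) _ fun θ => Or.inl (Complex.exp_ne_zero _)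
  · refine .of_forall fun θ _ => le_of_eq ?_
    simp [norm_zpow, Complex.norm_exp_ofReal_mul_I]
  · exact .of_forall fun _ _ => hbound
  · exact intervalIntegrable_const
  · refine .of_forall fun θ _ => ?_
    set w := Complex.exp (θ * Complex.I)
    have hw0 : w ≠ 0 := Complex.exp_ne_zero _
    have hsum := summable_mul_of_summable_norm
      (f := fun n : ℕ => (a * w⁻¹) ^ n / (n.factorial : ℂ))
      (g := fun n : ℕ => (b * w) ^ n / (n.factorial : ℂ)) (hnorm _) (hnorm _)
    have hs := ((hexp (a * w⁻¹)).mul (hexp (b * w)) hsum).mul_right (w ^ m)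
    rw [← Complex.exp_add] at hs
    refine (congrArg (HasSum · _) (funext fun p => ?_)).mpr hs
    rw [zpow_add₀ hw0, zpow_sub₀ hw0, zpow_natCast, zpow_natCast, mul_pow, mul_pow, inv_pow]
    ring

/-- Nonnegative moments of `exp (a * e^{-iθ} + b * e^{iθ})` over the circle. -/
theorem integral_exp_mul_pow (k : ℕ) (a b : ℂ) :
    (∫ θ in (0:ℝ)..(2 * π),
        Complex.exp (a * (Complex.exp (θ * Complex.I))⁻¹ + b * Complex.exp (θ * Complex.I)) *
          Complex.exp (θ * Complex.I) ^ (k : ℤ))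
      = 2 * π * ∑' n : ℕ, a ^ (k + n) * b ^ n / ((n.factorial : ℂ) * ((k + n).factorial : ℂ)) := by
  have hinj : Function.Injective fun n : ℕ => (k + n, n) := fun _ _ h => (Prod.ext_iff.1 h).2
  have h := (hinj.hasSum_iff fun p hp => ?_).2 (hasSum_integral_exp_mul_zpow k a b)
  · rw [← h.tsum_eq, ← tsum_mul_left]
    refine tsum_congr fun n => ?_
    simp only [Function.comp_apply]
    rw [if_pos (by push_cast; ring)]
    field_simp
  · rw [if_neg fun h0 => hp ⟨p.2, Prod.ext (by simp only; lia) rfl⟩, mul_zero]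

/-- Nonpositive moments of `exp (a * e^{-iθ} + b * e^{iθ})` over the circle. -/
theorem integral_exp_mul_zpow_neg (k : ℕ) (a b : ℂ) :
    (∫ θ in (0:ℝ)..(2 * π),
        Complex.exp (a * (Complex.exp (θ * Complex.I))⁻¹ + b * Complex.exp (θ * Complex.I)) *
          Complex.exp (θ * Complex.I) ^ (-k : ℤ))
      = 2 * π * ∑' n : ℕ, b ^ (k + n) * a ^ n / ((n.factorial : ℂ) * ((k + n).factorial : ℂ)) := by
  have hinj : Function.Injective fun n : ℕ => (n, k + n) := fun _ _ h => (Prod.ext_iff.1 h).1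
  have h := (hinj.hasSum_iff fun p hp => ?_).2 (hasSum_integral_exp_mul_zpow (-k) a b)
  · rw [← h.tsum_eq, ← tsum_mul_left]
    refine tsum_congr fun n => ?_
    simp only [Function.comp_apply]
    rw [if_pos (by push_cast; ring)]
    field_simp
  · rw [if_neg fun h0 => hp ⟨p.1, Prod.ext rfl (by simp only; lia)⟩, mul_zero]

theorem cos_mul_add_sin_mul_eq (θ : ℝ) (ξ₁ ξ₂ : ℂ) :
    (Real.cos θ : ℂ) * ξ₁ + (Real.sin θ : ℂ) * ξ₂
      = (ξ₁ + Complex.I * ξ₂) / 2 * (Complex.exp (θ * Complex.I))⁻¹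
        + (ξ₁ - Complex.I * ξ₂) / 2 * Complex.exp (θ * Complex.I) := by
  rw [← Complex.exp_neg, ← neg_mul, Complex.exp_mul_I, Complex.exp_mul_I, Complex.cos_neg,
    Complex.sin_neg, Complex.ofReal_cos, Complex.ofReal_sin]
  linear_combination ξ₂ * Complex.sin θ * Complex.I_sq

/-- value of `(1/2π) ∫_{S¹} e^{ϑ·ξ} (ϑ₁+iϑ₂)^m dσ(ϑ)` for `ξ ∈ ℂ²`. -/
theorem circle_moment_integral (m : ℤ) (ξ₁ ξ₂ : ℂ) :
    (0 ≤ m →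
      (1 / (2 * (π : ℂ))) *
          ∫ θ in (0:ℝ)..(2 * π),
            Complex.exp ((Real.cos θ : ℂ) * ξ₁ + (Real.sin θ : ℂ) * ξ₂) *
              (Complex.exp (θ * Complex.I)) ^ m
        = ((ξ₁ + Complex.I * ξ₂) / 2) ^ m.toNat *
            ∑' n : ℕ,
              ((ξ₁ - Complex.I * ξ₂) * (ξ₁ + Complex.I * ξ₂)) ^ n /
                (4 ^ n * (n.factorial : ℂ) * ((m.toNat + n).factorial : ℂ))) ∧
    (m < 0 →
      (1 / (2 * (π : ℂ))) *
          ∫ θ in (0:ℝ)..(2 * π),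
            Complex.exp ((Real.cos θ : ℂ) * ξ₁ + (Real.sin θ : ℂ) * ξ₂) *
              (Complex.exp (θ * Complex.I)) ^ m
        = ((ξ₁ - Complex.I * ξ₂) / 2) ^ (-m).toNat *
            ∑' n : ℕ,
              ((ξ₁ - Complex.I * ξ₂) * (ξ₁ + Complex.I * ξ₂)) ^ n /
                (4 ^ n * (n.factorial : ℂ) * (((-m).toNat + n).factorial : ℂ))) := by
  have hpi : (2 * (π : ℂ)) ≠ 0 := by simp [Real.pi_ne_zero]
  simp_rw [cos_mul_add_sin_mul_eq]
  refine ⟨fun hm => ?_, fun hm => ?_⟩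
  · lift m to ℕ using hm
    rw [integral_exp_mul_pow, ← mul_assoc, one_div_mul_cancel hpi, one_mul, ← tsum_mul_left,
      Int.toNat_natCast]
    refine tsum_congr fun n => ?_
    rw [pow_add, mul_pow, div_pow _ _ n, div_pow _ _ n, show (4 : ℂ) = 2 * 2 by norm_num, mul_pow]
    field_simp
  · obtain ⟨k, rfl⟩ : ∃ k : ℕ, m = -k := ⟨(-m).toNat, by lia⟩
    rw [integral_exp_mul_zpow_neg, ← mul_assoc, one_div_mul_cancel hpi, one_mul, ← tsum_mul_left,
      neg_neg, Int.toNat_natCast]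
    refine tsum_congr fun n => ?_
    rw [pow_add, mul_pow, div_pow _ _ n, div_pow _ _ n, show (4 : ℂ) = 2 * 2 by norm_num, mul_pow]
    field_simp
end

section
/- Let m ≥ 0 be an integer and let a, b ∈ ℂ. Then the contour integral (1/(2πi)) ∮_{|w|=1} w^{m−1} e^{(a w + b w^{−1})/2} dw equals (b/2)^m Σ_{n=0}^∞ (ab)^n / (4^n n! (m+n)!); that is, the residue at w = 0 of w^{m−1} e^{(a w + b w^{−1})/2} equals (b/2)^m Σ_{n=0}^∞ (ab)^n / (4^n n! (m+n)!). -/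
open MeasureTheory Real

theorem hasSum_circleIntegral_of_summable_norm {ι : Type*} [Countable ι] {F : ι → ℂ → ℂ}
    {f : ℂ → ℂ} {c : ℂ} {R : ℝ} {u : ι → ℝ} (hR : 0 ≤ R) (hu : Summable u)
    (hF : ∀ i, ContinuousOn (F i) (Metric.sphere c R))
    (hb : ∀ i, ∀ z ∈ Metric.sphere c R, ‖F i z‖ ≤ u i)
    (hs : ∀ z ∈ Metric.sphere c R, HasSum (fun i => F i z) (f z)) :
    HasSum (fun i => ∮ z in C(c, R), F i z) (∮ z in C(c, R), f z) := by
  refine intervalIntegral.hasSum_integral_of_dominated_convergence (fun i _ => R * u i)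
    (fun i => ?_) (fun i => ?_) ?_ ?_ ?_
  · exact ((hF i).circleIntegrable hR).out.aestronglyMeasurable_restrict_uIoc
  · refine Filter.Eventually.of_forall fun θ _ => ?_
    rw [norm_smul, deriv_circleMap, norm_mul, Complex.norm_I, mul_one, norm_circleMap_zero,
      abs_of_nonneg hR]
    exact mul_le_mul_of_nonneg_left (hb i _ (circleMap_mem_sphere c hR θ)) hR
  · exact Filter.Eventually.of_forall fun _ _ => hu.mul_left R
  · exact intervalIntegrable_const
  · exact Filter.Eventually.of_forall fun θ _ =>
      (hs _ (circleMap_mem_sphere c hR θ)).const_smul _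

theorem summable_norm_pow_div_factorial_mul (x y : ℂ) :
    Summable fun p : ℕ × ℕ => ‖x ^ p.1 / p.1.factorial * (y ^ p.2 / p.2.factorial)‖ :=
  Summable.mul_norm (f := fun n : ℕ => x ^ n / (n.factorial : ℂ))
    (g := fun n : ℕ => y ^ n / (n.factorial : ℂ))
    (NormedSpace.norm_expSeries_div_summable x) (NormedSpace.norm_expSeries_div_summable y)

theorem hasSum_exp_mul_exp (x y : ℂ) :
    HasSum (fun p : ℕ × ℕ => x ^ p.1 / p.1.factorial * (y ^ p.2 / p.2.factorial))
      (Complex.exp (x + y)) := by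
  rw [Complex.exp_add, Complex.exp_eq_exp_ℂ]
  exact HasSum.mul (f := fun n : ℕ => x ^ n / (n.factorial : ℂ))
    (g := fun n : ℕ => y ^ n / (n.factorial : ℂ))
    (NormedSpace.expSeries_div_hasSum_exp x) (NormedSpace.expSeries_div_hasSum_exp y)
    (summable_norm_pow_div_factorial_mul x y).of_norm

theorem circleIntegral_zpow (n : ℤ) :
    (∮ w in C(0, 1), w ^ n) = if n = -1 then 2 * (π : ℂ) * Complex.I else 0 := by
  split_ifs with h
  · simpa [h] using circleIntegral.integral_sub_center_inv 0 one_ne_zero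
  · simpa using circleIntegral.integral_sub_zpow_of_ne h 0 0 1

/-- residue at `w = 0` of `w^{m-1} e^{(aw + b w⁻¹)/2}`, expressed via the
contour integral over the positively oriented unit circle. -/
theorem residue_of_exponential (m : ℕ) (a b : ℂ) :
    (1 / (2 * (π : ℂ) * Complex.I)) *
        (∮ w in C(0, 1), w ^ ((m : ℤ) - 1) * Complex.exp ((a * w + b * w⁻¹) / 2))
      = (b / 2) ^ m *
          ∑' n : ℕ, (a * b) ^ n / (4 ^ n * (n.factorial : ℂ) * ((m + n).factorial : ℂ)) := by
  set A : ℕ × ℕ → ℂ := fun p =>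
    (a / 2) ^ p.1 / p.1.factorial * ((b / 2) ^ p.2 / p.2.factorial) with hA
  have hu : Summable fun p => ‖A p‖ :=
    summable_norm_pow_div_factorial_mul (a / 2) (b / 2)
  have hne : ∀ z ∈ Metric.sphere (0 : ℂ) 1, z ≠ 0 := fun z hz =>
    Metric.ne_of_mem_sphere hz one_ne_zero
  have hsum := hasSum_circleIntegral_of_summable_norm (c := 0) (R := 1)
    (F := fun p w => A p * w ^ ((m : ℤ) - 1 + p.1 - p.2))
    (f := fun w => w ^ ((m : ℤ) - 1) * Complex.exp ((a * w + b * w⁻¹) / 2)) zero_le_one hu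
    (fun p => continuousOn_const.mul (continuousOn_id.zpow₀ _ fun z hz => Or.inl (hne z hz)))
    (fun p z hz => by simp [mem_sphere_zero_iff_norm.mp hz])
    (fun z hz => by
      have hz0 := hne z hz
      rw [add_div]
      refine (congrArg (HasSum · _) (funext fun p => ?_)).mp
        ((hasSum_exp_mul_exp (a * z / 2) (b * z⁻¹ / 2)).mul_left (z ^ ((m : ℤ) - 1)))
      rw [zpow_sub₀ hz0 _ (p.2 : ℤ), zpow_add₀ hz0 _ (p.1 : ℤ), zpow_natCast, zpow_natCast]
      simp only [hA, div_pow, mul_pow, inv_pow]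
      field_simp)
  simp only [circleIntegral.integral_const_mul, circleIntegral_zpow] at hsum
  have hinj : Function.Injective fun n : ℕ => (n, m + n) := fun _ _ h => congrArg Prod.fst h
  rw [← hinj.hasSum_iff] at hsum
  · rw [← (hsum.mul_left (1 / (2 * (π : ℂ) * Complex.I))).tsum_eq, ← tsum_mul_left]
    refine tsum_congr fun n => ?_
    have hn : (m : ℤ) - 1 + n - (m + n : ℕ) = -1 := by push_cast; ring
    simp only [Function.comp_apply, hn, if_true, hA]
    have h4 : (4 : ℂ) ^ n = 2 ^ n * 2 ^ n := by rw [← mul_pow]; norm_num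
    have hpi := Complex.two_pi_I_ne_zero
    rw [mul_comm (_ / _ * _) (2 * (π : ℂ) * Complex.I), ← mul_assoc, one_div_mul_cancel hpi, h4]
    simp only [div_pow, mul_pow, pow_add]
    field_simp
  · rintro ⟨j, k⟩ h
    rw [if_neg, mul_zero]
    intro h'
    exact h ⟨j, Prod.ext rfl (by simp only at h' ⊢; omega)⟩
end

section
/- Let k > 0, τ > 0 and ω ∈ S¹. Then for every r ≥ 0 and θ ∈ ℝ, with y = (r cos θ, r sin θ): exp(τ y·ω + i√(τ²+k²) y·ω⊥) = Σ_{m=0}^∞ ((τ−√(τ²+k²)) ω̄ /k)^m J_m(kr) e^{imθ} + Σ_{m=0}^∞ ((τ+√(τ²+k²)) ω /k)^m J_m(kr) e^{−imθ} − J₀(kr), where both series converge. -/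
open MeasureTheory Real

/-- The Bessel function of integer order `m ≥ 0`, defined by its power series. -/
noncomputable def besselJ (m : ℕ) (z : ℂ) : ℂ :=
  (z / 2) ^ m * ∑' n : ℕ, ((-1 : ℂ) ^ n / ((n.factorial : ℂ) * ((n + m).factorial : ℂ))) * (z / 2) ^ (2 * n)

/-- A summable double series is the sum over `q ≤ p` plus the sum over `p ≤ q` minus the diagonal. -/
theorem tsum_prod_eq_add_sub_diagonal {f : ℕ × ℕ → ℂ} (hf : Summable f) :
    ∑' p, f p = (∑' p : ℕ × ℕ, f (p.2 + p.1, p.2)) + (∑' p : ℕ × ℕ, f (p.2, p.2 + p.1))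
      - ∑' n : ℕ, f (n, n) := by
  have indicator_sum : ∀ {α : Type} (e : α → ℕ × ℕ), Function.Injective e →
      HasSum ((Set.range e).indicator f) (∑' a, f (e a)) := by
    intro α e he
    have h : HasSum (((Set.range e).indicator f) ∘ e) (∑' a, f (e a)) := by
      have : ((Set.range e).indicator f) ∘ e = f ∘ e := by
        ext a
        simp
      rw [this]
      exact (hf.comp_injective he).hasSum
    exact (he.hasSum_iff fun x hx => Set.indicator_of_notMem hx f).1 h
  have lower := indicator_sum (fun p : ℕ × ℕ => (p.2 + p.1, p.2)) (by
    rintro ⟨a, b⟩ ⟨c, d⟩ h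
    simp only [Prod.mk.injEq] at h ⊢
    omega)
  have upper := indicator_sum (fun p : ℕ × ℕ => (p.2, p.2 + p.1)) (by
    rintro ⟨a, b⟩ ⟨c, d⟩ h
    simp only [Prod.mk.injEq] at h ⊢
    omega)
  have diag := indicator_sum (fun n : ℕ => (n, n)) (by
    intro a b h
    simpa using h)
  rw [← ((lower.add upper).sub diag).tsum_eq]
  refine tsum_congr ?_
  rintro ⟨p, q⟩
  have mem_lower : (p, q) ∈ Set.range (fun p : ℕ × ℕ => (p.2 + p.1, p.2)) ↔ q ≤ p := by
    constructor
    · rintro ⟨⟨a, b⟩, h⟩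
      simp only [Prod.mk.injEq] at h
      omega
    · intro h
      exact ⟨(p - q, q), by simp [Nat.add_sub_cancel' h]⟩
  have mem_upper : (p, q) ∈ Set.range (fun p : ℕ × ℕ => (p.2, p.2 + p.1)) ↔ p ≤ q := by
    constructor
    · rintro ⟨⟨a, b⟩, h⟩
      simp only [Prod.mk.injEq] at h
      omega
    · intro h
      exact ⟨(q - p, p), by simp [Nat.add_sub_cancel' h]⟩
  have mem_diag : (p, q) ∈ Set.range (fun n : ℕ => (n, n)) ↔ p = q := by
    simp only [Set.mem_range, Prod.mk.injEq]
    exact ⟨fun ⟨n, h₁, h₂⟩ => h₁.symm.trans h₂, fun h => ⟨p, rfl, h⟩⟩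
  simp only [Set.indicator, mem_lower, mem_upper, mem_diag]
  rcases lt_trichotomy p q with h | h | h
  · simp [h.le, h.not_ge, h.ne]
  · simp [h]
  · simp [h.le, h.not_ge, h.ne']

/-- The product of the terms of the exponential series of `x * a` and `x * b`. -/
noncomputable def expProdTerm (x a b : ℂ) (p : ℕ × ℕ) : ℂ :=
  ((x * a) ^ p.1 / (p.1.factorial : ℂ)) * ((x * b) ^ p.2 / (p.2.factorial : ℂ))

theorem summable_expProdTerm (x a b : ℂ) : Summable (expProdTerm x a b) := by
  have h := summable_mul_of_summable_norm (NormedSpace.norm_expSeries_div_summable (x * a))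
    (NormedSpace.norm_expSeries_div_summable (x * b))
  exact h

theorem tsum_expProdTerm (x a b : ℂ) :
    ∑' p, expProdTerm x a b p = Complex.exp (x * (a + b)) := by
  rw [mul_add, Complex.exp_add, Complex.exp_eq_exp_ℂ, NormedSpace.exp_eq_tsum_div]
  exact (tsum_mul_tsum_of_summable_norm (NormedSpace.norm_expSeries_div_summable (x * a))
    (NormedSpace.norm_expSeries_div_summable (x * b))).symm

theorem expProdTerm_swap (x a b : ℂ) (p q : ℕ) :
    expProdTerm x a b (p, q) = expProdTerm x b a (q, p) :=
  mul_comm _ _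

theorem tsum_expProdTerm_shift (x a b : ℂ) (hab : a * b = -1) (m : ℕ) :
    ∑' n : ℕ, expProdTerm x a b (n + m, n) = a ^ m * besselJ m (2 * x) := by
  rw [besselJ, mul_div_cancel_left₀ x two_ne_zero, ← mul_assoc, ← tsum_mul_left]
  refine tsum_congr fun n => ?_
  simp only [expProdTerm]
  rw [← hab]
  have h₁ : ((n + m).factorial : ℂ) ≠ 0 := by exact_mod_cast (n + m).factorial_ne_zero
  have h₂ : (n.factorial : ℂ) ≠ 0 := by exact_mod_cast n.factorial_ne_zero
  field_simp
  ring

theorem summable_expProdTerm_shift (x a b : ℂ) :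
    Summable fun p : ℕ × ℕ => expProdTerm x a b (p.2 + p.1, p.2) := by
  refine (summable_expProdTerm x a b).comp_injective
    (i := fun p : ℕ × ℕ => (p.2 + p.1, p.2)) ?_
  rintro ⟨p, q⟩ ⟨r, s⟩ h
  simp only [Prod.mk.injEq] at h ⊢
  omega

theorem hasSum_pow_mul_besselJ (x a b : ℂ) (hab : a * b = -1) :
    HasSum (fun m : ℕ => a ^ m * besselJ m (2 * x))
      (∑' p : ℕ × ℕ, expProdTerm x a b (p.2 + p.1, p.2)) := by
  have hs := summable_expProdTerm_shift x a b
  have h := hs.hasSum.prod_fiberwise fun m => (hs.prod_factor m).hasSum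
  simpa only [tsum_expProdTerm_shift x a b hab] using h

/-- The generating function of the Bessel functions of integer order. -/
theorem exp_eq_besselJ_generating (x a b : ℂ) (hab : a * b = -1) :
    ∃ S₁ S₂ : ℂ, HasSum (fun m : ℕ => a ^ m * besselJ m (2 * x)) S₁ ∧
      HasSum (fun m : ℕ => b ^ m * besselJ m (2 * x)) S₂ ∧
      Complex.exp (x * (a + b)) = S₁ + S₂ - besselJ 0 (2 * x) := by
  refine ⟨_, _, hasSum_pow_mul_besselJ x a b hab,
    hasSum_pow_mul_besselJ x b a (by rw [mul_comm, hab]), ?_⟩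
  have h := tsum_expProdTerm_shift x a b hab 0
  simp only [add_zero, pow_zero, one_mul] at h
  rw [← tsum_expProdTerm, tsum_prod_eq_add_sub_diagonal (summable_expProdTerm x a b), h]
  simp only [expProdTerm_swap x b a]

/-- the expansion of `exp(τ y·ω + i√(τ²+k²) y·ω⊥)` in Bessel series,
for `y = (r cos θ, r sin θ)`; both series converge. -/
theorem exp_complex_plane_wave_expansion (k τ : ℝ) (hk : 0 < k) (hτ : 0 < τ)
    (ω₁ ω₂ : ℝ) (hω : ω₁ ^ 2 + ω₂ ^ 2 = 1) (r θ : ℝ) (hr : 0 ≤ r) :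
    ∃ S₁ S₂ : ℂ,
      HasSum (fun m : ℕ =>
        ((((τ - Real.sqrt (τ ^ 2 + k ^ 2)) / k : ℝ) : ℂ) * ((ω₁ : ℂ) - Complex.I * (ω₂ : ℂ))) ^ m *
          besselJ m (k * r) * Complex.exp ((m : ℂ) * (θ : ℂ) * Complex.I)) S₁ ∧
      HasSum (fun m : ℕ =>
        ((((τ + Real.sqrt (τ ^ 2 + k ^ 2)) / k : ℝ) : ℂ) * ((ω₁ : ℂ) + Complex.I * (ω₂ : ℂ))) ^ m *
          besselJ m (k * r) * Complex.exp (-((m : ℂ) * (θ : ℂ)) * Complex.I)) S₂ ∧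
      Complex.exp ((τ * (r * Real.cos θ * ω₁ + r * Real.sin θ * ω₂) : ℝ) +
          Complex.I * (Real.sqrt (τ ^ 2 + k ^ 2) * (r * Real.cos θ * ω₂ - r * Real.sin θ * ω₁) : ℝ))
        = S₁ + S₂ - besselJ 0 (k * r) := by
  set s := Real.sqrt (τ ^ 2 + k ^ 2) with hs
  have hs2 : (s : ℂ) ^ 2 = (τ : ℂ) ^ 2 + (k : ℂ) ^ 2 := by
    exact_mod_cast Real.sq_sqrt (by positivity : 0 ≤ τ ^ 2 + k ^ 2)
  have hkc : (k : ℂ) ≠ 0 := by exact_mod_cast hk.ne'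
  have hωc : (ω₁ : ℂ) ^ 2 + (ω₂ : ℂ) ^ 2 = 1 := by exact_mod_cast hω
  have hinv : Complex.exp ((θ : ℂ) * Complex.I) * Complex.exp (-(θ : ℂ) * Complex.I) = 1 := by
    rw [← Complex.exp_add]
    simp
  obtain ⟨S₁, S₂, h₁, h₂, h⟩ := exp_eq_besselJ_generating ((k : ℂ) * r / 2)
    ((((τ - s) / k : ℝ) : ℂ) * ((ω₁ : ℂ) - Complex.I * (ω₂ : ℂ)) *
      Complex.exp ((θ : ℂ) * Complex.I))
    ((((τ + s) / k : ℝ) : ℂ) * ((ω₁ : ℂ) + Complex.I * (ω₂ : ℂ)) *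
      Complex.exp (-(θ : ℂ) * Complex.I)) (by
    have hω' : ((ω₁ : ℂ) - Complex.I * ω₂) * ((ω₁ : ℂ) + Complex.I * ω₂) = 1 := by
      linear_combination hωc - (ω₂ : ℂ) ^ 2 * Complex.I_sq
    have hτs : (((τ - s) / k : ℝ) : ℂ) * (((τ + s) / k : ℝ) : ℂ) = -1 := by
      push_cast
      field_simp
      linear_combination -hs2
    calc _ = ((((τ - s) / k : ℝ) : ℂ) * (((τ + s) / k : ℝ) : ℂ)) *
          (((ω₁ : ℂ) - Complex.I * ω₂) * ((ω₁ : ℂ) + Complex.I * ω₂)) *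
          (Complex.exp ((θ : ℂ) * Complex.I) * Complex.exp (-(θ : ℂ) * Complex.I)) := by ring
      _ = -1 := by rw [hω', hτs, hinv]; ring)
  rw [mul_div_cancel₀ _ (two_ne_zero : (2 : ℂ) ≠ 0)] at h
  simp only [mul_div_cancel₀ _ (two_ne_zero : (2 : ℂ) ≠ 0)] at h₁ h₂
  refine ⟨S₁, S₂, ?_, ?_, ?_⟩
  · convert h₁ using 2 with m
    rw [mul_pow _ (Complex.exp _), ← Complex.exp_nat_mul, ← mul_assoc (m : ℂ)]
    ring
  · convert h₂ using 2 with m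
    rw [mul_pow _ (Complex.exp _), ← Complex.exp_nat_mul, ← mul_assoc (m : ℂ), mul_neg]
    ring
  · rw [← h, Complex.exp_mul_I, Complex.exp_mul_I, Complex.cos_neg, Complex.sin_neg]
    congr 1
    push_cast
    field_simp
    ring_nf
    simp only [Complex.I_sq]
    ring
end

section
/- Let k > 0 and let m ≥ 0 be an integer. Let v be the harmonic function v(x) = (x₁ + ix₂)^m on ℝ². Then for every x = (r cos θ, r sin θ) with r > 0: T_k v(x) = (2/k)^m m! J_m(kr) e^{imθ}. Likewise, for v(x) = (x₁ − ix₂)^m: T_k v(x) = (2/k)^m m! J_m(kr) e^{−imθ}. -/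
open MeasureTheory Real

/-- The two-dimensional Vekua transform
`T_k v(x) = v(x) - (k|x|/2) ∫₀¹ v(tx) J₁(k|x|√(1-t)) dt/√(1-t)`. -/
noncomputable def vekua (k : ℝ) (v : ℝ × ℝ → ℂ) (x : ℝ × ℝ) : ℂ :=
  v x - ((k * Real.sqrt (x.1 ^ 2 + x.2 ^ 2) / 2 : ℝ) : ℂ) *
    ∫ t in (0:ℝ)..1,
      v (t * x.1, t * x.2) * besselJ 1 ((k * Real.sqrt (x.1 ^ 2 + x.2 ^ 2) * Real.sqrt (1 - t) : ℝ)) /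
        ((Real.sqrt (1 - t) : ℝ) : ℂ)

theorem integral_pow_mul_one_sub_pow (m n : ℕ) :
    ∫ t in (0:ℝ)..1, (t : ℂ) ^ m * (1 - (t : ℂ)) ^ n
      = (m.factorial : ℂ) * (n.factorial : ℂ) / ((m + n + 1).factorial : ℂ) := by
  have h := Complex.Gamma_mul_Gamma_eq_betaIntegral (s := (m : ℂ) + 1) (t := (n : ℂ) + 1)
    (by simp; positivity) (by simp; positivity)
  have e : (m : ℂ) + 1 + (n + 1) = ((m + n + 1 : ℕ) : ℂ) + 1 := by push_cast; ring
  rw [e, Complex.Gamma_nat_eq_factorial, Complex.Gamma_nat_eq_factorial,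
    Complex.Gamma_nat_eq_factorial, Complex.betaIntegral] at h
  simp only [add_sub_cancel_right, Complex.cpow_natCast] at h
  rw [h, mul_div_cancel_left₀]
  exact_mod_cast Nat.factorial_ne_zero _

theorem summable_norm_besselJ_term (m : ℕ) (w : ℂ) :
    Summable fun n : ℕ =>
      ‖((-1 : ℂ) ^ n / ((n.factorial : ℂ) * ((n + m).factorial : ℂ))) * w ^ (2 * n)‖ := by
  refine (Real.summable_pow_div_factorial (‖w‖ ^ 2)).of_nonneg_of_le (fun _ => norm_nonneg _) ?_
  intro n
  have h1 : (1 : ℝ) ≤ ((n + m).factorial : ℝ) := by exact_mod_cast Nat.factorial_pos _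
  have h0 : (0 : ℝ) < (n.factorial : ℝ) := by exact_mod_cast Nat.factorial_pos _
  simp only [norm_mul, norm_div, norm_pow, norm_neg, norm_one, one_pow, Complex.norm_natCast]
  rw [pow_mul, div_mul_eq_mul_div, one_mul]
  gcongr
  nlinarith

theorem besselJ_one_mul_sqrt_div_sqrt (a t : ℝ) (ht : t < 1) :
    besselJ 1 ((a * √(1 - t) : ℝ)) / ((√(1 - t) : ℝ) : ℂ)
      = ((a : ℂ) / 2) * ∑' n : ℕ, ((-1 : ℂ) ^ n / ((n.factorial : ℂ) * ((n + 1).factorial : ℂ))) *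
          ((a : ℂ) / 2) ^ (2 * n) * (1 - (t : ℂ)) ^ n := by
  have hs : ((√(1 - t) : ℝ) : ℂ) ≠ 0 := by
    exact_mod_cast (Real.sqrt_pos.2 (sub_pos.2 ht)).ne'
  have hsq : ((√(1 - t) : ℝ) : ℂ) ^ 2 = 1 - (t : ℂ) := by
    rw [← Complex.ofReal_pow, Real.sq_sqrt (sub_pos.2 ht).le]; simp
  have hterm (n : ℕ) : ((((a * √(1 - t) : ℝ)) : ℂ) / 2) ^ (2 * n)
      = ((a : ℂ) / 2) ^ (2 * n) * (1 - (t : ℂ)) ^ n := by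
    rw [Complex.ofReal_mul, mul_div_right_comm, mul_pow, pow_mul ((√(1 - t) : ℝ) : ℂ), hsq]
  simp only [besselJ, hterm, ← mul_assoc]
  rw [Complex.ofReal_mul, pow_one]
  field_simp

theorem hasSum_integral_pow_mul_besselJ_one (a : ℝ) (m : ℕ) :
    HasSum (fun n : ℕ => ((a : ℂ) / 2) *
        (((-1 : ℂ) ^ n / ((n.factorial : ℂ) * ((n + 1).factorial : ℂ))) * ((a : ℂ) / 2) ^ (2 * n)) *
        ((m.factorial : ℂ) * (n.factorial : ℂ) / ((m + n + 1).factorial : ℂ)))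
      (∫ t in (0:ℝ)..1, (t : ℂ) ^ m * (besselJ 1 ((a * √(1 - t) : ℝ)) / ((√(1 - t) : ℝ) : ℂ))) := by
  set c : ℕ → ℂ := fun n => ((-1 : ℂ) ^ n / ((n.factorial : ℂ) * ((n + 1).factorial : ℂ))) *
    ((a : ℂ) / 2) ^ (2 * n)
  have hsum : Summable fun n => ‖c n‖ := summable_norm_besselJ_term 1 _
  have hbound (n : ℕ) (t : ℝ) (ht : t ∈ Set.uIoc (0:ℝ) 1) :
      ‖c n * (1 - (t : ℂ)) ^ n‖ ≤ ‖c n‖ := by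
    rw [Set.uIoc_of_le zero_le_one] at ht
    rw [norm_mul, norm_pow]
    refine mul_le_of_le_one_right (norm_nonneg _) (pow_le_one₀ (norm_nonneg _) ?_)
    rw [← Complex.ofReal_one, ← Complex.ofReal_sub, Complex.norm_real, Real.norm_eq_abs, abs_le]
    constructor <;> linarith [ht.1, ht.2]
  have key := intervalIntegral.hasSum_integral_of_dominated_convergence (μ := volume)
    (a := 0) (b := 1)
    (F := fun n (t : ℝ) => ((a : ℂ) / 2) * c n * ((t : ℂ) ^ m * (1 - (t : ℂ)) ^ n))
    (f := fun t : ℝ => (t : ℂ) ^ m *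
      (besselJ 1 ((a * √(1 - t) : ℝ)) / ((√(1 - t) : ℝ) : ℂ)))
    (fun n _ => ‖(a : ℂ) / 2‖ * ‖c n‖)
    (fun n => Continuous.aestronglyMeasurable (by fun_prop)) ?_ ?_ ?_ ?_
  · simpa only [intervalIntegral.integral_const_mul, integral_pow_mul_one_sub_pow] using key
  · refine fun n => ae_of_all _ fun t ht => ?_
    have h := hbound n t ht
    rw [Set.uIoc_of_le zero_le_one] at ht
    have ht1 : ‖(t : ℂ) ^ m‖ ≤ 1 := by
      rw [norm_pow, Complex.norm_real, Real.norm_of_nonneg ht.1.le]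
      exact pow_le_one₀ ht.1.le ht.2
    calc ‖((a : ℂ) / 2) * c n * ((t : ℂ) ^ m * (1 - (t : ℂ)) ^ n)‖
        = ‖(a : ℂ) / 2‖ * (‖(t : ℂ) ^ m‖ * ‖c n * (1 - (t : ℂ)) ^ n‖) := by
          simp only [norm_mul]; ring
      _ ≤ ‖(a : ℂ) / 2‖ * (1 * ‖c n‖) := by gcongr
      _ = _ := by rw [one_mul]
  · exact ae_of_all _ fun t _ => hsum.mul_left _
  · exact intervalIntegrable_const
  · filter_upwards [Measure.ae_ne volume (1 : ℝ)] with t ht1 ht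
    have hb := fun n => hbound n t ht
    rw [Set.uIoc_of_le zero_le_one] at ht
    rw [besselJ_one_mul_sqrt_div_sqrt a t (lt_of_le_of_ne ht.2 ht1)]
    have h := ((Summable.of_norm_bounded hsum hb).hasSum.mul_left ((a : ℂ) / 2)).mul_left
      ((t : ℂ) ^ m)
    refine h.congr_fun ?_
    intro n
    ring

theorem one_sub_integral_pow_mul_besselJ_one (a : ℝ) (m : ℕ) :
    ((a : ℂ) / 2) ^ m * (1 - ((a : ℂ) / 2) *
      ∫ t in (0:ℝ)..1, (t : ℂ) ^ m * (besselJ 1 ((a * √(1 - t) : ℝ)) / ((√(1 - t) : ℝ) : ℂ)))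
      = (m.factorial : ℂ) * besselJ m a := by
  rw [besselJ, ((summable_norm_besselJ_term m ((a : ℂ) / 2)).of_norm).tsum_eq_zero_add,
    ← (hasSum_integral_pow_mul_besselJ_one a m).tsum_eq, ← tsum_mul_left]
  have hm : (m.factorial : ℂ) ≠ 0 := by exact_mod_cast Nat.factorial_ne_zero _
  rw [mul_left_comm, mul_add, ← tsum_mul_left, sub_eq_add_neg, ← tsum_neg]
  congr 2
  · simp [hm]
  · refine tsum_congr fun n => ?_
    have hn : (n.factorial : ℂ) ≠ 0 := by exact_mod_cast Nat.factorial_ne_zero _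
    have hn1 : ((n + 1).factorial : ℂ) ≠ 0 := by exact_mod_cast Nat.factorial_ne_zero _
    have hmn : ((m + n + 1).factorial : ℂ) ≠ 0 := by exact_mod_cast Nat.factorial_ne_zero _
    rw [show n + 1 + m = m + n + 1 by ring]
    field_simp
    ring

theorem vekua_of_homogeneous (k : ℝ) (hk : 0 < k) (m : ℕ) (r θ : ℝ) (hr : 0 < r)
    (v : ℝ × ℝ → ℂ) (w : ℂ)
    (hv : ∀ t : ℝ, v (t * (r * Real.cos θ), t * (r * Real.sin θ)) = (t * (r * w)) ^ m) :
    vekua k v (r * Real.cos θ, r * Real.sin θ)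
      = (2 / (k : ℂ)) ^ m * (m.factorial : ℂ) * besselJ m (k * r) * w ^ m := by
  have hnorm : √((r * Real.cos θ) ^ 2 + (r * Real.sin θ) ^ 2) = r := by
    rw [mul_pow, mul_pow, ← mul_add, Real.cos_sq_add_sin_sq, mul_one, Real.sqrt_sq hr.le]
  have hv1 : v (r * Real.cos θ, r * Real.sin θ) = (r * w) ^ m := by simpa using hv 1
  have hkC : (k : ℂ) ≠ 0 := by exact_mod_cast hk.ne'
  have hpow : (2 / (k : ℂ)) ^ m * ((k * r : ℝ) / 2 : ℂ) ^ m = (r : ℂ) ^ m := by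
    rw [← mul_pow]; congr 1; push_cast; field_simp
  have key := one_sub_integral_pow_mul_besselJ_one (k * r) m
  have hint : ∀ t : ℝ, (t * (r * w)) ^ m * besselJ 1 ((k * r * √(1 - t) : ℝ)) /
      ((√(1 - t) : ℝ) : ℂ) = (r * w) ^ m * ((t : ℂ) ^ m *
        (besselJ 1 ((k * r * √(1 - t) : ℝ)) / ((√(1 - t) : ℝ) : ℂ))) := by
    intro t; rw [mul_pow (t : ℂ)]; ring
  rw [Complex.ofReal_mul k r] at key
  rw [mul_assoc (_ ^ m), ← key, ← Complex.ofReal_mul, ← mul_assoc, hpow]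
  simp only [vekua, hnorm, hv, hv1, hint, intervalIntegral.integral_const_mul]
  push_cast
  ring

/-- the Vekua transform maps `(x₁+ix₂)^m` to `(2/k)^m m! J_m(kr) e^{imθ}` and
`(x₁-ix₂)^m` to `(2/k)^m m! J_m(kr) e^{-imθ}`. -/
theorem vekua_of_harmonic_monomial (k : ℝ) (hk : 0 < k) (m : ℕ) (r θ : ℝ) (hr : 0 < r) :
    vekua k (fun x => ((x.1 : ℂ) + Complex.I * (x.2 : ℂ)) ^ m) (r * Real.cos θ, r * Real.sin θ)
        = (2 / (k : ℂ)) ^ m * (m.factorial : ℂ) * besselJ m (k * r) *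
            Complex.exp ((m : ℂ) * (θ : ℂ) * Complex.I) ∧
    vekua k (fun x => ((x.1 : ℂ) - Complex.I * (x.2 : ℂ)) ^ m) (r * Real.cos θ, r * Real.sin θ)
        = (2 / (k : ℂ)) ^ m * (m.factorial : ℂ) * besselJ m (k * r) *
            Complex.exp (-((m : ℂ) * (θ : ℂ)) * Complex.I) := by
  constructor
  · have h := vekua_of_homogeneous k hk m r θ hr
      (fun x => ((x.1 : ℂ) + Complex.I * (x.2 : ℂ)) ^ m) (Complex.exp (θ * Complex.I)) ?_
    · rw [h, ← Complex.exp_nat_mul, mul_assoc (m : ℂ)]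
    · intro t
      rw [Complex.exp_mul_I]
      push_cast
      ring
  · have h := vekua_of_homogeneous k hk m r θ hr
      (fun x => ((x.1 : ℂ) - Complex.I * (x.2 : ℂ)) ^ m) (Complex.exp (-θ * Complex.I)) ?_
    · rw [h, ← Complex.exp_nat_mul]
      congr 2
      ring
    · intro t
      rw [Complex.exp_mul_I, Complex.cos_neg, Complex.sin_neg]
      push_cast
      ring
end

section
/- Let k > 0, τ > 0 and ω ∈ S¹. The Vekua transform T_k of the harmonic function e_ω(·; τ, k) coincides with the function y ↦ exp(τ y·ω + i√(τ²+k²) y·ω⊥); that is, for every y ∈ ℝ², T_k(e_ω(·; τ, k))(y) = exp(τ y·ω + i√(τ²+k²) y·ω⊥). -/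
open MeasureTheory Real

/-- The harmonic function
`e_ω(y;τ,k) = exp((τ-√(τ²+k²)) ω̄ (y₁+iy₂)/2) + exp((τ+√(τ²+k²)) ω (y₁-iy₂)/2) - 1`. -/
noncomputable def eHarm (τ k ω₁ ω₂ : ℝ) (y : ℝ × ℝ) : ℂ :=
  Complex.exp (((τ - Real.sqrt (τ ^ 2 + k ^ 2) : ℝ) : ℂ) * ((ω₁ : ℂ) - Complex.I * (ω₂ : ℂ)) *
      ((y.1 : ℂ) + Complex.I * (y.2 : ℂ)) / 2) +
  Complex.exp (((τ + Real.sqrt (τ ^ 2 + k ^ 2) : ℝ) : ℂ) * ((ω₁ : ℂ) + Complex.I * (ω₂ : ℂ)) *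
      ((y.1 : ℂ) - Complex.I * (y.2 : ℂ)) / 2) - 1

open Finset in
/-- The derivative of `exp (t C)` times the exponential Taylor polynomial of `(1 - t) C`. -/
lemma hasDerivAt_exp_mul_taylor (C : ℂ) (n : ℕ) (t : ℂ) :
    HasDerivAt
      (fun t : ℂ => Complex.exp (t * C) * ∑ j ∈ range (n + 1), ((1 - t) * C) ^ j / (j.factorial : ℂ))
      (C ^ (n + 1) * ((1 - t) ^ n / (n.factorial : ℂ) * Complex.exp (t * C))) t := by
  have hexp : HasDerivAt (fun t : ℂ => Complex.exp (t * C)) (Complex.exp (t * C) * C) t := by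
    simpa using ((hasDerivAt_id t).mul_const C).cexp
  induction n with
  | zero => simpa [mul_comm] using hexp
  | succ n ih =>
    have hlin : HasDerivAt (fun t : ℂ => (1 - t) * C) (-C) t := by
      simpa using ((hasDerivAt_id t).const_sub 1).mul_const C
    have hlast := hexp.mul ((hlin.pow (n + 1)).div_const ((n + 1).factorial : ℂ))
    have hn : (n.factorial : ℂ) ≠ 0 := by exact_mod_cast n.factorial_ne_zero
    have hn1 : (n : ℂ) + 1 ≠ 0 := by exact_mod_cast n.succ_ne_zero
    refine ((ih.add hlast).congr_deriv ?_).congr_of_eventuallyEq (.of_forall fun s => ?_)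
    · simp only [Nat.factorial_succ, Nat.cast_mul, Nat.cast_add, Nat.cast_one,
        Nat.add_sub_cancel, Pi.pow_apply, mul_pow]
      field_simp
      ring
    · simp [sum_range_succ _ (n + 1), mul_add]

open Finset in
/-- Taylor's formula for `exp` with integral remainder. -/
lemma pow_mul_integral_exp (C : ℂ) (n : ℕ) :
    C ^ (n + 1) * ∫ t in (0:ℝ)..1, (1 - (t : ℂ)) ^ n / (n.factorial : ℂ) * Complex.exp (t * C) =
      Complex.exp C - ∑ j ∈ range (n + 1), C ^ j / (j.factorial : ℂ) := by
  rw [← intervalIntegral.integral_const_mul,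
    intervalIntegral.integral_eq_sub_of_hasDerivAt
      (fun t _ => (hasDerivAt_exp_mul_taylor C n t).comp_ofReal)
      (Continuous.intervalIntegrable (by fun_prop) _ _)]
  simp [sum_range_succ']

lemma integral_one_sub_pow_div_factorial (n : ℕ) :
    ∫ t in (0:ℝ)..1, (1 - (t : ℂ)) ^ n / (n.factorial : ℂ) = 1 / ((n + 1).factorial : ℂ) := by
  have hn1 : (n : ℂ) + 1 ≠ 0 := by exact_mod_cast n.succ_ne_zero
  have hd (t : ℂ) : HasDerivAt (fun t : ℂ => -((1 - t) ^ (n + 1) / ((n + 1).factorial : ℂ)))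
      ((1 - t) ^ n / (n.factorial : ℂ)) t := by
    refine (((((hasDerivAt_id t).const_sub 1).pow (n + 1)).div_const
      ((n + 1).factorial : ℂ)).neg).congr_deriv ?_
    have hn : (n.factorial : ℂ) ≠ 0 := by exact_mod_cast n.factorial_ne_zero
    simp only [Nat.factorial_succ, Nat.cast_mul, Nat.cast_add, Nat.cast_one,
      Nat.add_sub_cancel, id]
    field_simp
  rw [intervalIntegral.integral_eq_sub_of_hasDerivAt (fun t _ => (hd t).comp_ofReal)
      (Continuous.intervalIntegrable (by fun_prop) _ _)]
  simp

/-- The power series of `J₁`, as a convergent sum. -/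
lemma hasSum_besselJ_one (z : ℂ) :
    HasSum (fun n : ℕ => z / 2 *
      (((-1 : ℂ) ^ n / ((n.factorial : ℂ) * ((n + 1).factorial : ℂ))) * (z / 2) ^ (2 * n)))
      (besselJ 1 z) := by
  rw [besselJ, pow_one]
  refine (Summable.hasSum ?_).mul_left _
  refine Summable.of_norm_bounded (Real.summable_pow_div_factorial (‖z / 2‖ ^ 2)) fun n => ?_
  have h1 : (1 : ℝ) ≤ ((n + 1).factorial : ℝ) := by exact_mod_cast (n + 1).factorial_pos
  have h0 : (0 : ℝ) < (n.factorial : ℝ) := by exact_mod_cast n.factorial_pos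
  simp only [norm_mul, norm_div, norm_pow, norm_neg, norm_one, one_pow, Complex.norm_natCast,
    pow_mul]
  rw [one_div_mul_eq_div]
  gcongr
  nlinarith

/-- Termwise integration of the Bessel kernel of the Vekua transform. -/
lemma hasSum_vekua_kernel (ρ : ℝ) {w : ℝ → ℂ} (hw : Continuous w) :
    HasSum (fun n : ℕ => (-((ρ : ℂ) / 2) ^ 2) ^ (n + 1) / ((n + 1).factorial : ℂ) *
        ∫ t in (0:ℝ)..1, (1 - (t : ℂ)) ^ n / (n.factorial : ℂ) * w t)
      (-(((ρ / 2 : ℝ) : ℂ) * ∫ t in (0:ℝ)..1,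
        w t * besselJ 1 ((ρ * √(1 - t) : ℝ)) / ((√(1 - t) : ℝ) : ℂ))) := by
  obtain ⟨M, hM⟩ := (isCompact_Icc (a := (0:ℝ)) (b := 1)).exists_bound_of_continuousOn
    hw.continuousOn
  have hM0 : 0 ≤ M := (norm_nonneg _).trans (hM 0 (by simp))
  set q : ℂ := -((ρ : ℂ) / 2) ^ 2 with hq
  have key : HasSum (fun n : ℕ => ∫ t in (0:ℝ)..1, (ρ : ℂ) / 2 * (q ^ n / ((n + 1).factorial : ℂ)) *
        ((1 - (t : ℂ)) ^ n / (n.factorial : ℂ) * w t))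
      (∫ t in (0:ℝ)..1, w t * besselJ 1 ((ρ * √(1 - t) : ℝ)) / ((√(1 - t) : ℝ) : ℂ)) := by
    refine intervalIntegral.hasSum_integral_of_dominated_convergence
      (fun n _ => ‖(ρ : ℂ) / 2‖ * M * (‖q‖ ^ n / (n.factorial : ℝ)))
      (fun n => (Continuous.aestronglyMeasurable (by fun_prop))) ?_ ?_ ?_ ?_
    · refine fun n => .of_forall fun t ht => ?_
      rw [Set.uIoc_of_le zero_le_one] at ht
      have h1 : (1 : ℝ) ≤ ((n + 1).factorial : ℝ) := by exact_mod_cast (n + 1).factorial_pos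
      have h0 : (0 : ℝ) < (n.factorial : ℝ) := by exact_mod_cast n.factorial_pos
      have ht1 : ‖(1 - (t : ℂ))‖ ≤ 1 := by
        rw [← Complex.ofReal_one, ← Complex.ofReal_sub, Complex.norm_real, Real.norm_eq_abs,
          abs_le]
        constructor <;> linarith [ht.1, ht.2]
      calc _ = ‖(ρ : ℂ) / 2‖ * ‖w t‖ * (‖q‖ ^ n * ‖1 - (t : ℂ)‖ ^ n /
            (((n + 1).factorial : ℝ) * (n.factorial : ℝ))) := by
            simp only [norm_mul, norm_div, norm_pow, Complex.norm_natCast]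
            field_simp
        _ ≤ ‖(ρ : ℂ) / 2‖ * M * (‖q‖ ^ n * 1 / (1 * (n.factorial : ℝ))) := by
            gcongr
            · exact hM t ⟨ht.1.le, ht.2⟩
            · exact pow_le_one₀ (norm_nonneg _) ht1
        _ = _ := by simp
    · exact .of_forall fun t _ => (Real.summable_pow_div_factorial ‖q‖).mul_left _
    · exact intervalIntegrable_const
    · have hne : ∀ᵐ t : ℝ, t ≠ 1 := by simp [ae_iff, measure_singleton]
      filter_upwards [hne] with t ht1 ht
      rw [Set.uIoc_of_le zero_le_one] at ht
      have hpos : 0 < 1 - t := sub_pos.2 (lt_of_le_of_ne ht.2 ht1)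
      have hs : ((√(1 - t) : ℝ) : ℂ) ≠ 0 := by
        exact_mod_cast (Real.sqrt_pos.2 hpos).ne'
      have hsq : ((√(1 - t) : ℝ) : ℂ) ^ 2 = 1 - (t : ℂ) := by
        rw [← Complex.ofReal_pow, Real.sq_sqrt hpos.le]
        simp
      refine (((hasSum_besselJ_one ((ρ * √(1 - t) : ℝ) : ℂ)).mul_left (w t)).div_const
        ((√(1 - t) : ℝ) : ℂ)).congr_fun ?_
      intro n
      have h1 : ((n + 1).factorial : ℂ) ≠ 0 := by exact_mod_cast (n + 1).factorial_ne_zero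
      have h0 : (n.factorial : ℂ) ≠ 0 := by exact_mod_cast n.factorial_ne_zero
      rw [← hsq, hq, neg_pow (((ρ : ℂ) / 2) ^ 2), ← pow_mul, ← pow_mul, Complex.ofReal_mul,
        mul_div_right_comm (ρ : ℂ), mul_pow ((ρ : ℂ) / 2)]
      field_simp
  refine ((key.mul_left (((ρ / 2 : ℝ) : ℂ))).neg).congr_fun ?_
  intro n
  rw [intervalIntegral.integral_const_mul, hq]
  push_cast
  ring

open Finset in
/-- The Vekua series applied to `e^{tA} + e^{tB} - 1` telescopes. -/
lemma tendsto_vekua_series (A B : ℂ) :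
    Filter.Tendsto (fun N : ℕ => ∑ n ∈ range N, (A * B) ^ (n + 1) / ((n + 1).factorial : ℂ) *
        ∫ t in (0:ℝ)..1, (1 - (t : ℂ)) ^ n / (n.factorial : ℂ) *
          (Complex.exp (t * A) + Complex.exp (t * B) - 1)) Filter.atTop
      (nhds (Complex.exp (A + B) - (Complex.exp A + Complex.exp B - 1))) := by
  set S : ℂ → ℕ → ℂ := fun C n => ∑ j ∈ range n, C ^ j / (j.factorial : ℂ) with hS
  have hterm (n : ℕ) : (A * B) ^ (n + 1) / ((n + 1).factorial : ℂ) *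
        ∫ t in (0:ℝ)..1, (1 - (t : ℂ)) ^ n / (n.factorial : ℂ) *
          (Complex.exp (t * A) + Complex.exp (t * B) - 1) =
      B ^ (n + 1) / ((n + 1).factorial : ℂ) * (Complex.exp A - S A (n + 1)) +
      A ^ (n + 1) / ((n + 1).factorial : ℂ) * (Complex.exp B - S B (n + 1)) -
      A ^ (n + 1) / ((n + 1).factorial : ℂ) * (B ^ (n + 1) / ((n + 1).factorial : ℂ)) := by
    simp only [hS]
    rw [← pow_mul_integral_exp A n, ← pow_mul_integral_exp B n]
    simp only [mul_add, mul_sub, mul_one]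
    rw [intervalIntegral.integral_sub (Continuous.intervalIntegrable (by fun_prop) _ _)
        (Continuous.intervalIntegrable (by fun_prop) _ _),
      intervalIntegral.integral_add (Continuous.intervalIntegrable (by fun_prop) _ _)
        (Continuous.intervalIntegrable (by fun_prop) _ _),
      integral_one_sub_pow_div_factorial]
    ring
  have hsum (N : ℕ) : ∑ n ∈ range N, (A * B) ^ (n + 1) / ((n + 1).factorial : ℂ) *
        ∫ t in (0:ℝ)..1, (1 - (t : ℂ)) ^ n / (n.factorial : ℂ) *
          (Complex.exp (t * A) + Complex.exp (t * B) - 1) =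
      (S B (N + 1) - 1) * Complex.exp A + (S A (N + 1) - 1) * Complex.exp B -
        (S A (N + 1) * S B (N + 1) - 1) := by
    induction N with
    | zero => simp [hS]
    | succ N ih =>
      rw [sum_range_succ, ih, hterm]
      have h (C : ℂ) : S C (N + 1 + 1) = S C (N + 1) + C ^ (N + 1) / ((N + 1).factorial : ℂ) :=
        sum_range_succ _ _
      rw [h A, h B]
      ring
  have hlim (C : ℂ) : Filter.Tendsto (fun N => S C (N + 1)) Filter.atTop (nhds (Complex.exp C)) := by
    have h := (NormedSpace.expSeries_div_hasSum_exp C).tendsto_sum_nat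
    rw [← Complex.exp_eq_exp_ℂ] at h
    exact h.comp (Filter.tendsto_add_atTop_nat 1)
  simp only [hsum]
  convert ((((hlim B).sub_const 1).mul_const (Complex.exp A)).add
    (((hlim A).sub_const 1).mul_const (Complex.exp B))).sub
    (((hlim A).mul (hlim B)).sub_const 1) using 2
  rw [Complex.exp_add]
  ring

/-- the Vekua transform of `e_ω(·;τ,k)` is
`y ↦ exp(τ y·ω + i√(τ²+k²) y·ω⊥)`. -/
theorem vekua_of_eHarm (k τ : ℝ) (hk : 0 < k) (hτ : 0 < τ)
    (ω₁ ω₂ : ℝ) (hω : ω₁ ^ 2 + ω₂ ^ 2 = 1) :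
    ∀ y : ℝ × ℝ,
      vekua k (eHarm τ k ω₁ ω₂) y
        = Complex.exp ((τ * (y.1 * ω₁ + y.2 * ω₂) : ℝ) +
            Complex.I * (Real.sqrt (τ ^ 2 + k ^ 2) * (y.1 * ω₂ - y.2 * ω₁) : ℝ)) := by
  rintro ⟨y₁, y₂⟩
  set s := √(τ ^ 2 + k ^ 2) with hs
  set r := √(y₁ ^ 2 + y₂ ^ 2) with hr
  set A : ℂ := ((τ - s : ℝ) : ℂ) * ((ω₁ : ℂ) - Complex.I * ω₂) * (y₁ + Complex.I * y₂) / 2 with hA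
  set B : ℂ := ((τ + s : ℝ) : ℂ) * ((ω₁ : ℂ) + Complex.I * ω₂) * (y₁ - Complex.I * y₂) / 2 with hB
  have hs2 : (s : ℂ) ^ 2 = τ ^ 2 + k ^ 2 := by
    rw [← Complex.ofReal_pow, Real.sq_sqrt (by positivity)]
    simp
  have hr2 : (r : ℂ) ^ 2 = y₁ ^ 2 + y₂ ^ 2 := by
    rw [← Complex.ofReal_pow, Real.sq_sqrt (by positivity)]
    simp
  have hω' : (ω₁ : ℂ) ^ 2 + ω₂ ^ 2 = 1 := by exact_mod_cast hω
  have hAB : A * B = -(((k * r : ℝ) : ℂ) / 2) ^ 2 := by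
    have hI := Complex.I_sq
    have h1 : ((ω₁ : ℂ) - Complex.I * ω₂) * (ω₁ + Complex.I * ω₂) = 1 := by
      linear_combination hω' - ω₂ ^ 2 * hI
    have h2 : ((y₁ : ℂ) + Complex.I * y₂) * (y₁ - Complex.I * y₂) = (r : ℂ) ^ 2 := by
      linear_combination -hr2 - y₂ ^ 2 * hI
    have h3 : ((τ : ℂ) - s) * (τ + s) = -(k : ℂ) ^ 2 := by linear_combination -hs2
    calc A * B = (((τ : ℂ) - s) * (τ + s)) * (((ω₁ : ℂ) - Complex.I * ω₂) * (ω₁ + Complex.I * ω₂)) *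
          (((y₁ : ℂ) + Complex.I * y₂) * (y₁ - Complex.I * y₂)) / 4 := by
          rw [hA, hB]
          push_cast
          ring
      _ = _ := by
          rw [h1, h2, h3]
          push_cast
          ring
  have hexp : ((τ * (y₁ * ω₁ + y₂ * ω₂) : ℝ) : ℂ) + Complex.I * ((s * (y₁ * ω₂ - y₂ * ω₁) : ℝ) : ℂ) =
      A + B := by
    rw [hA, hB]
    push_cast
    linear_combination (τ * ω₂ * y₂ : ℂ) * Complex.I_sq
  have hv (t : ℝ) : eHarm τ k ω₁ ω₂ (t * y₁, t * y₂) =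
      Complex.exp (t * A) + Complex.exp (t * B) - 1 := by
    simp only [eHarm, hA, hB, ← hs]
    push_cast
    congr 3 <;> ring
  have hv1 : eHarm τ k ω₁ ω₂ (y₁, y₂) = Complex.exp A + Complex.exp B - 1 := rfl
  have hsum := hasSum_vekua_kernel (k * r)
    (w := fun t => Complex.exp (t * A) + Complex.exp (t * B) - 1) (by fun_prop)
  rw [← hAB] at hsum
  have hlim := tendsto_nhds_unique hsum.tendsto_sum_nat (tendsto_vekua_series A B)
  simp only [vekua, hv, hv1, ← hr]
  rw [hexp]
  linear_combination hlim
end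

section
/- Let k > 0, R > 0, and let β > 0 satisfy 2β/e + log β < 0 (equivalently, 0 < β < β₀, where β₀ is the unique positive solution of (2/e)s + log s = 0). Let (τ(N))_{N≥1} be a sequence of positive numbers such that τ(N) = βN/(eR) + O(1) as N → ∞. Then e^{R τ(N)} E(τ(N); N−1) = O(N^{−∞}); that is, for every p > 0, N^p e^{R τ(N)} E(τ(N); N−1) → 0 as N → ∞. -/
open MeasureTheory Real Filter

/-- `E(τ;N) = (1/N!) (R(τ+√(τ²+k²))/2)^N exp(R(τ+√(τ²+k²))/2)`. -/
noncomputable def Efun (k R τ : ℝ) (N : ℕ) : ℝ :=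
  (1 / (N.factorial : ℝ)) * (R * (τ + Real.sqrt (τ ^ 2 + k ^ 2)) / 2) ^ N *
    Real.exp (R * (τ + Real.sqrt (τ ^ 2 + k ^ 2)) / 2)

/-- A linear upper bound `y ≤ βN/e + A` makes `y ^ (N-1) / (N-1)!` at most a constant times
`β ^ N` (here `N = n + 1`). -/
theorem pow_div_factorial_le_const_mul_pow {β A y : ℝ} (hβ : 0 < β) (hA : 0 ≤ A) (hy0 : 0 ≤ y)
    (n : ℕ) (hy : y ≤ β * (n + 1 : ℕ) / Real.exp 1 + A) :
    y ^ n / (n.factorial : ℝ) ≤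
      Real.exp 1 / β * Real.exp (A * Real.exp 1 / β) * β ^ (n + 1) := by
  have he : 0 < Real.exp 1 := Real.exp_pos 1
  have hN : (0 : ℝ) < (n + 1 : ℕ) := by positivity
  set M : ℝ := ((n + 1 : ℕ) : ℝ) with hM
  set B : ℝ := β * M / Real.exp 1 with hB
  have hB0 : 0 < B := by positivity
  have hlin : B + A ≤ B * Real.exp (A / B) := by
    have h := mul_le_mul_of_nonneg_left (Real.add_one_le_exp (A / B)) hB0.le
    have h2 : B * (A / B + 1) = B + A := by field_simp; ring
    linarith
  have hpow : (B + A) ^ (n + 1) ≤ B ^ (n + 1) * Real.exp (A * Real.exp 1 / β) := by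
    calc (B + A) ^ (n + 1) ≤ (B * Real.exp (A / B)) ^ (n + 1) := by gcongr
      _ = B ^ (n + 1) * Real.exp (A * Real.exp 1 / β) := by
        rw [mul_pow, ← Real.exp_nat_mul, ← hM]
        congr 2
        rw [hB]
        field_simp
  have hyB : y ^ n * B ≤ (B + A) ^ (n + 1) := by
    rw [pow_succ]
    gcongr
    linarith
  have hfac : ((n + 1).factorial : ℝ) = M * n.factorial := by
    rw [Nat.factorial_succ, Nat.cast_mul]
  have hexp : M ^ (n + 1) ≤ Real.exp 1 ^ (n + 1) * (M * n.factorial) := by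
    have h := Real.pow_div_factorial_le_exp M hN.le (n + 1)
    rw [hfac, div_le_iff₀ (by positivity)] at h
    rwa [← Real.exp_nat_mul, mul_one]
  have hBpow : B ^ (n + 1) ≤ β ^ (n + 1) * (M * n.factorial) := by
    rw [hB, div_pow, mul_pow, div_le_iff₀ (by positivity)]
    calc β ^ (n + 1) * M ^ (n + 1)
        ≤ β ^ (n + 1) * (Real.exp 1 ^ (n + 1) * (M * n.factorial)) := by gcongr
      _ = _ := by ring
  rw [div_le_iff₀ (by positivity)]
  refine le_of_mul_le_mul_right ?_ hB0
  calc y ^ n * B ≤ B ^ (n + 1) * Real.exp (A * Real.exp 1 / β) := hyB.trans hpow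
    _ ≤ β ^ (n + 1) * (M * n.factorial) * Real.exp (A * Real.exp 1 / β) := by gcongr
    _ = _ := by
      rw [hB]
      field_simp

/-- The argument of the exponential in `Efun` exceeds `R τ` by at most `R k / 2`. -/
theorem mul_add_sqrt_div_two_le {k R τ : ℝ} (hk : 0 ≤ k) (hR : 0 ≤ R) (hτ : 0 ≤ τ) :
    R * (τ + Real.sqrt (τ ^ 2 + k ^ 2)) / 2 ≤ R * τ + R * k / 2 := by
  have h : Real.sqrt (τ ^ 2 + k ^ 2) ≤ τ + k :=
    Real.sqrt_le_iff.mpr ⟨by positivity, by nlinarith [mul_nonneg hτ hk]⟩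
  nlinarith [mul_le_mul_of_nonneg_left h hR]

/-- if `0 < β` with `2β/e + log β < 0` and `τ(N) = βN/(eR) + O(1)`, then
`e^{Rτ(N)} E(τ(N); N-1) = O(N^{-∞})`. -/
theorem exp_E_rapid_decay (k R β : ℝ) (hk : 0 < k) (hR : 0 < R) (hβ : 0 < β)
    (hβ0 : 2 * β / Real.exp 1 + Real.log β < 0)
    (τ : ℕ → ℝ) (hτpos : ∀ N : ℕ, 1 ≤ N → 0 < τ N)
    (hτ : ∃ C : ℝ, 0 < C ∧ ∃ N₀ : ℕ, ∀ N : ℕ, N₀ ≤ N →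
      |τ N - β * N / (Real.exp 1 * R)| ≤ C) :
    ∀ p : ℝ, 0 < p →
      Tendsto (fun N : ℕ => (N : ℝ) ^ p * (Real.exp (R * τ N) * Efun k R (τ N) (N - 1)))
        atTop (nhds 0) := by
  intro p _
  obtain ⟨C, hC, N₀, hN₀⟩ := hτ
  set A : ℝ := R * C + R * k / 2 with hA
  have hA0 : 0 ≤ A := by positivity
  set c : ℝ := -(2 * β / Real.exp 1 + Real.log β) with hc
  have hc0 : 0 < c := by linarith
  set K : ℝ := Real.exp (2 * A) * (Real.exp 1 / β * Real.exp (A * Real.exp 1 / β)) with hK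
  have hlim : Tendsto (fun N : ℕ => K * ((N : ℝ) ^ p * Real.exp (-c * N))) atTop (nhds 0) := by
    simpa using ((tendsto_rpow_mul_exp_neg_mul_atTop_nhds_zero p c hc0).comp
      tendsto_natCast_atTop_atTop).const_mul K
  refine squeeze_zero' ?_ ?_ hlim
  · filter_upwards [eventually_ge_atTop 1] with N hN
    have := hτpos N hN
    unfold Efun
    positivity
  · filter_upwards [eventually_ge_atTop 1, eventually_ge_atTop N₀] with N hN hNN
    have hτN := hτpos N hN
    have hRτ : R * τ N ≤ β * N / Real.exp 1 + R * C := by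
      have h := mul_le_mul_of_nonneg_left (abs_le.mp (hN₀ N hNN)).2 hR.le
      have h2 : R * (τ N - β * N / (Real.exp 1 * R)) = R * τ N - β * N / Real.exp 1 := by
        field_simp
      linarith
    have hx := mul_add_sqrt_div_two_le hk.le hR.le hτN.le
    have hx0 : 0 ≤ R * (τ N + Real.sqrt (τ N ^ 2 + k ^ 2)) / 2 := by positivity
    unfold Efun
    set x : ℝ := R * (τ N + Real.sqrt (τ N ^ 2 + k ^ 2)) / 2
    have hxA : x ≤ β * N / Real.exp 1 + A := by linarith
    obtain ⟨n, rfl⟩ : ∃ n, N = n + 1 := ⟨N - 1, by omega⟩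
    have hbound := pow_div_factorial_le_const_mul_pow hβ hA0 hx0 n hxA
    have hexp : Real.exp (R * τ (n + 1)) * Real.exp x ≤
        Real.exp (2 * A) * Real.exp (2 * β / Real.exp 1 * (n + 1 : ℕ)) := by
      rw [← Real.exp_add, ← Real.exp_add]
      apply Real.exp_le_exp.mpr
      have h : 2 * β / Real.exp 1 * (n + 1 : ℕ) = 2 * (β * (n + 1 : ℕ) / Real.exp 1) := by ring
      have hRk : 0 ≤ R * k / 2 := by positivity
      linarith
    have hβpow : Real.exp (2 * β / Real.exp 1 * (n + 1 : ℕ)) * β ^ (n + 1) =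
        Real.exp (-c * (n + 1 : ℕ)) := by
      rw [hc, neg_neg, add_mul, Real.exp_add, mul_comm (Real.log β), Real.exp_nat_mul,
        Real.exp_log hβ]
    rw [Nat.add_sub_cancel, ← hβpow]
    calc ((n + 1 : ℕ) : ℝ) ^ p *
          (Real.exp (R * τ (n + 1)) * (1 / (n.factorial : ℝ) * x ^ n * Real.exp x))
        = ((n + 1 : ℕ) : ℝ) ^ p *
          ((Real.exp (R * τ (n + 1)) * Real.exp x) * (x ^ n / (n.factorial : ℝ))) := by ring
      _ ≤ ((n + 1 : ℕ) : ℝ) ^ p *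
          ((Real.exp (2 * A) * Real.exp (2 * β / Real.exp 1 * (n + 1 : ℕ))) *
            (Real.exp 1 / β * Real.exp (A * Real.exp 1 / β) * β ^ (n + 1))) := by gcongr
      _ = _ := by rw [hK]; ring
end
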